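/- arXiv:1702.01377 — 2 statements merged into one kernel-verified Lean document; each statement's English description precedes it below -/
import Mathlib

section
/- (Interpolation property.) Let k be a nonempty index. For every integer N≥0, the Kawashima function satisfies F_k(N) = S⋆(k,N). -/
open MeasureTheory Filter Topology

namespace Kawashima

/-- The set `A(k) = {k₁, k₁+k₂, …, k₁+⋯+k_{r-1}}` of proper nonempty partial sums
of an index `k = (k₁, …, k_r)`. -/
def Aset (k : List ℕ) : Finset ℕ :=
  (Finset.Ico 1 k.length).image (fun i => (k.take i).sum)

/-- The Hoffman dual of an index `k`: the unique index `k∨` with the same weight such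
that `A(k)` and `A(k∨)` partition `{1, …, wt(k) - 1}`.  It is computed here as the
composition of `wt(k)` whose partial-sum set is the complement of `A(k)`. -/
def hdual (k : List ℕ) : List ℕ :=
  let w := k.sum
  let L := (insert w ((Finset.Icc 1 (w - 1)) \ Aset k)).sort (· ≤ ·)
  L.zipWith (fun a b => a - b) (0 :: L)

/-- `sStar k N = s⋆(k, N) = Σ_{0 < m₁ ≤ ⋯ ≤ m_{r-1} ≤ m_r = N} 1/(m₁^{k₁} ⋯ m_r^{k_r})`.
For the empty index the value is `1` (empty product), and for a nonempty index and
`N = 0` the value is `0` (empty sum). -/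
noncomputable def sStar (k : List ℕ) (N : ℕ) : ℝ :=
  ∑ m : Fin k.length → Fin (N + 1),
    if (∀ i, 0 < (m i : ℕ)) ∧
       (∀ i j : Fin k.length, i ≤ j → (m i : ℕ) ≤ (m j : ℕ)) ∧
       (∀ i : Fin k.length, (i : ℕ) + 1 = k.length → (m i : ℕ) = N)
    then ∏ i : Fin k.length, 1 / ((m i : ℕ) : ℝ) ^ k.get i
    else 0

/-- `SStar k N = S⋆(k, N) = Σ_{n=1}^N s⋆(k, n)`. -/
noncomputable def SStar (k : List ℕ) (N : ℕ) : ℝ :=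
  ∑ n ∈ Finset.Icc 1 N, sStar k n

/-- The binomial coefficient `binom(z, n) = z(z-1)⋯(z-n+1)/n!` for complex `z`. -/
noncomputable def cbinom (z : ℂ) (n : ℕ) : ℂ :=
  (descPochhammer ℂ n).eval z / (n.factorial : ℂ)

/-- The Kawashima function
`F_k(z) = Σ_{n=1}^∞ (-1)^{n-1} s⋆(k∨, n) binom(z, n)`, with `F_∅(z) = 1`. -/
noncomputable def F (k : List ℕ) (z : ℂ) : ℂ :=
  if k = [] then 1
  else ∑' n : ℕ, (-1 : ℂ) ^ n * ((sStar (hdual k) (n + 1) : ℝ) : ℂ) * cbinom z (n + 1)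

/-- The domain `Δ(k) ⊆ (0,1)^{wt(k)}`: `t_j < t_{j+1}` if `j ∈ A(k)` and
`t_j > t_{j+1}` otherwise (positions `1`-indexed). -/
def Delta (k : List ℕ) : Set (Fin k.sum → ℝ) :=
  {t | (∀ j, t j ∈ Set.Ioo (0 : ℝ) 1) ∧
       ∀ (i : Fin k.sum) (h : (i : ℕ) + 1 < k.sum),
         if (i : ℕ) + 1 ∈ Aset k then t i < t ⟨(i : ℕ) + 1, h⟩
         else t ⟨(i : ℕ) + 1, h⟩ < t i}

/-- The multiple zeta value `ζ(k) = Σ_{0 < m₁ < ⋯ < m_r} 1/(m₁^{k₁} ⋯ m_r^{k_r})`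
(as a `tsum`; it converges for admissible `k`), with `ζ(∅) = 1`. -/
noncomputable def mzv (k : List ℕ) : ℝ :=
  ∑' m : Fin k.length → ℕ,
    if (∀ i, 0 < m i) ∧ (∀ i j : Fin k.length, i < j → m i < m j)
    then ∏ i : Fin k.length, 1 / ((m i : ℕ) : ℝ) ^ k.get i
    else 0

/-- `ζ` extended `ℚ`-linearly to formal `ℚ`-linear combinations of indices. -/
noncomputable def zetaL (v : List ℕ →₀ ℚ) : ℝ :=
  v.sum fun k a => (a : ℝ) * mzv k

/-- The Kawashima function extended `ℚ`-linearly to formal combinations of indices. -/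
noncomputable def FL (v : List ℕ →₀ ℚ) (z : ℂ) : ℂ :=
  v.sum fun k a => (a : ℂ) * F k z

/-- Auxiliary harmonic product, on *reversed* indices (so that the rightmost entry of
the index is the head of the list):
`k * l = (k₋ * l, k_r) + (k * l₋, l_s) + (k₋ * l₋, k_r + l_s)`. -/
noncomputable def hstarAux : List ℕ → List ℕ → (List ℕ →₀ ℚ)
  | [], l => Finsupp.single l 1
  | a :: k, [] => Finsupp.single (a :: k) 1
  | a :: k, b :: l =>
      Finsupp.mapDomain (List.cons a) (hstarAux k (b :: l)) +
      Finsupp.mapDomain (List.cons b) (hstarAux (a :: k) l) +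
      Finsupp.mapDomain (List.cons (a + b)) (hstarAux k l)
  termination_by k l => k.length + l.length

/-- The harmonic product `k * l` of two indices, as a `ℚ`-linear combination of
indices. -/
noncomputable def hstar (k l : List ℕ) : List ℕ →₀ ℚ :=
  Finsupp.mapDomain List.reverse (hstarAux k.reverse l.reverse)

/-- Auxiliary product `*̄` on reversed indices:
`k *̄ l = (k₋ *̄ l, k_r) + (k *̄ l₋, l_s) - (k₋ *̄ l₋, k_r + l_s)`. -/
noncomputable def hbarAux : List ℕ → List ℕ → (List ℕ →₀ ℚ)
  | [], l => Finsupp.single l 1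
  | a :: k, [] => Finsupp.single (a :: k) 1
  | a :: k, b :: l =>
      Finsupp.mapDomain (List.cons a) (hbarAux k (b :: l)) +
      Finsupp.mapDomain (List.cons b) (hbarAux (a :: k) l) -
      Finsupp.mapDomain (List.cons (a + b)) (hbarAux k l)
  termination_by k l => k.length + l.length

/-- The harmonic product `k *̄ l` of two indices. -/
noncomputable def hbar (k l : List ℕ) : List ℕ →₀ ℚ :=
  Finsupp.mapDomain List.reverse (hbarAux k.reverse l.reverse)

/-- The product `k ⊛ l = (k₋ * l₋, k_r + l_s)` for nonempty indices `k`, `l`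
(and `0` if either is empty). -/
noncomputable def circAst (k l : List ℕ) : List ℕ →₀ ℚ :=
  match k.reverse, l.reverse with
  | a :: k', b :: l' =>
      Finsupp.mapDomain List.reverse
        (Finsupp.mapDomain (List.cons (a + b)) (hstarAux k' l'))
  | _, _ => 0

/-- `⊛` extended bilinearly to formal combinations. -/
noncomputable def circAstL (v w : List ℕ →₀ ℚ) : List ℕ →₀ ℚ :=
  v.sum fun k a => w.sum fun l b => (a * b) • circAst k l

/-- The star operator `k ↦ k⋆`: the sum over all ways to replace commas by pluses
in groups of consecutive entries,
`(k₁,…,k_r)⋆ = Σ_{0<j₁<⋯<j_q=r} (k₁+⋯+k_{j₁}, …, k_{j_{q-1}+1}+⋯+k_{j_q})`. -/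
noncomputable def starOp : List ℕ → (List ℕ →₀ ℚ)
  | [] => Finsupp.single [] 1
  | [a] => Finsupp.single [a] 1
  | a :: b :: k =>
      Finsupp.mapDomain (List.cons a) (starOp (b :: k)) + starOp ((a + b) :: k)
  termination_by k => k.length

/-- The star operator extended `ℚ`-linearly. -/
noncomputable def starL (v : List ℕ →₀ ℚ) : List ℕ →₀ ℚ :=
  v.sum fun k a => a • starOp k

open Classical in
/-- Kawashima's function `G_k(z)`: the sum over tuples `0 < n₁, …, n_w` with
`n_j < n_{j+1}` if `j ∉ A(k)` and `n_j ≤ n_{j+1}` if `j ∈ A(k)`, of the product of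
the factors `1/(n_j + z)` at positions `j ∈ A(k)`, the factor
`1/n_w - 1/(n_w + z)` at the last position, and `1/n_j` elsewhere. -/
noncomputable def G (k : List ℕ) (z : ℂ) : ℂ :=
  ∑' n : Fin k.sum → ℕ,
    if (∀ j, 0 < n j) ∧
       (∀ (i : Fin k.sum) (h : (i : ℕ) + 1 < k.sum),
          if (i : ℕ) + 1 ∈ Aset k then n i ≤ n ⟨(i : ℕ) + 1, h⟩
          else n i < n ⟨(i : ℕ) + 1, h⟩)
    then ∏ j : Fin k.sum,
      if (j : ℕ) + 1 = k.sum then 1 / ((n j : ℕ) : ℂ) - 1 / (((n j : ℕ) : ℂ) + z)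
      else if (j : ℕ) + 1 ∈ Aset k then 1 / (((n j : ℕ) : ℂ) + z)
      else 1 / ((n j : ℕ) : ℂ)
    else 0

open Classical in
/-- `ζ_k(l) = Σ 1/(n₁^{l₁} ⋯ n_w^{l_w})`, summed over the same set of tuples as in
the definition of `G_k`. -/
noncomputable def zetaIdx (k : List ℕ) (l : List ℕ) : ℝ :=
  ∑' n : Fin k.sum → ℕ,
    if (∀ j, 0 < n j) ∧
       (∀ (i : Fin k.sum) (h : (i : ℕ) + 1 < k.sum),
          if (i : ℕ) + 1 ∈ Aset k then n i ≤ n ⟨(i : ℕ) + 1, h⟩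
          else n i < n ⟨(i : ℕ) + 1, h⟩)
    then ∏ j : Fin k.sum, 1 / ((n j : ℕ) : ℝ) ^ (l.getD (j : ℕ) 0)
    else 0

/-- `C_m(k) = Σ_{l₁,…,l_{r-1} ≥ 0, l_r ≥ 1, l₁+⋯+l_r = m}
ζ_k(1,…,1 (k₁-1 ones), l₁+1, …, 1,…,1 (k_r-1 ones), l_r+1)`. -/
noncomputable def Cm (k : List ℕ) (m : ℕ) : ℝ :=
  ∑ l : Fin k.length → Fin (m + 1),
    if (∑ i, (l i : ℕ)) = m ∧
       (∀ i : Fin k.length, (i : ℕ) + 1 = k.length → 1 ≤ (l i : ℕ))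
    then zetaIdx k
      ((List.ofFn (fun i : Fin k.length =>
          List.replicate (k.get i - 1) 1 ++ [(l i : ℕ) + 1])).flatten)
    else 0

/-- The iterated integral `A_m(k)` over `Δ((k,1,…,1))` (`m` trailing ones) of
`ω_{δ(1)}(t₁) ⋯ ω_{δ(w-1)}(t_{w-1}) · dt_w/(1-t_w) · dt_{w+1}/t_{w+1} ⋯ dt_{w+m}/t_{w+m}`. -/
noncomputable def Aint (k : List ℕ) (m : ℕ) : ℝ :=
  ∫ t in Delta (k ++ List.replicate m 1),
    ∏ i : Fin (k ++ List.replicate m 1).sum,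
      if (i : ℕ) + 1 < k.sum then
        (if (i : ℕ) + 1 ∈ Aset k then 1 / (1 - t i) else 1 / t i)
      else if (i : ℕ) + 1 = k.sum then 1 / (1 - t i)
      else 1 / t i

/-- The digamma function `ψ(z) = Γ'(z)/Γ(z)`. -/
noncomputable def digamma (z : ℂ) : ℂ := deriv Complex.Gamma z / Complex.Gamma z


/-- Monotone tuples of length `r` with entries in `{1, …, N}`. -/
noncomputable def monoTuples (r N : ℕ) : Finset (Fin r → ℕ) :=
  open Classical in (Fintype.piFinset fun _ => Finset.Icc 1 N).filter Monotone

lemma mem_monoTuples {r N : ℕ} {m : Fin r → ℕ} :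
    m ∈ monoTuples r N ↔ (∀ i, 1 ≤ m i ∧ m i ≤ N) ∧ Monotone m := by
  simp [monoTuples, Fintype.mem_piFinset]

/-- Multiple harmonic star sum over monotone tuples, with no condition on the last entry. -/
noncomputable def starSum (e : ℕ → ℕ) (r N : ℕ) : ℝ :=
  ∑ m ∈ monoTuples r N, ∏ i : Fin r, 1 / (m i : ℝ) ^ e i

/-- Multiple harmonic star sum over monotone tuples whose last entry is `N`. -/
noncomputable def starSumLast (e : ℕ → ℕ) (r N : ℕ) : ℝ :=
  ∑ m ∈ (monoTuples r N).filter (fun m => ∀ i : Fin r, (i : ℕ) + 1 = r → m i = N),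
    ∏ i : Fin r, 1 / (m i : ℝ) ^ e i

lemma sStar_eq_starSumLast (k : List ℕ) (N : ℕ) :
    sStar k N = starSumLast (fun i => k.getD i 0) k.length N := by
  unfold sStar starSumLast
  rw [← Finset.sum_filter]
  refine Finset.sum_bij (fun m _ i => (m i : ℕ)) ?_ ?_ ?_ ?_
  · intro m hm
    simp only [Finset.mem_filter, Finset.mem_univ, true_and] at hm
    simp only [Finset.mem_filter, mem_monoTuples]
    exact ⟨⟨fun i => ⟨hm.1 i, Nat.lt_succ_iff.1 (m i).2⟩, fun i j h => hm.2.1 i j h⟩, hm.2.2⟩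
  · intro m _ m' _ h
    ext i
    exact congrFun h i
  · intro m hm
    simp only [Finset.mem_filter, mem_monoTuples] at hm
    refine ⟨fun i => ⟨m i, Nat.lt_succ_iff.2 (hm.1.1 i).2⟩, ?_, rfl⟩
    simp only [Finset.mem_filter, Finset.mem_univ, true_and]
    exact ⟨fun i => (hm.1.1 i).1, fun i j h => hm.1.2 h, hm.2⟩
  · intro m _
    refine Finset.prod_congr rfl fun i _ => ?_
    simp

lemma starSumLast_succ (e : ℕ → ℕ) (r : ℕ) {N : ℕ} (hN : 1 ≤ N) :
    starSumLast e (r + 1) N = starSum e r N / (N : ℝ) ^ e r := by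
  unfold starSumLast starSum
  rw [Finset.sum_div]
  symm
  refine Finset.sum_bij (fun m _ => Fin.snoc (α := fun _ => ℕ) m N) ?_ ?_ ?_ ?_
  · intro m hm
    rw [mem_monoTuples] at hm
    simp only [Finset.mem_filter, mem_monoTuples]
    refine ⟨⟨fun i => ?_, fun i j hij => ?_⟩, fun i hi => ?_⟩
    · induction i using Fin.lastCases with
      | last => simpa using hN
      | cast i => simpa using hm.1 i
    · induction j using Fin.lastCases with
      | last =>
        induction i using Fin.lastCases with
        | last => exact le_rfl
        | cast i => simpa using (hm.1 i).2
      | cast j =>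
        induction i using Fin.lastCases with
        | last => exact absurd hij (not_le.2 (Fin.castSucc_lt_last j))
        | cast i => simpa using hm.2 (Fin.castSucc_le_castSucc_iff.1 hij)
    · have : i = Fin.last r := Fin.ext (by simpa using hi)
      subst this
      simp
  · intro m _ m' _ h
    exact (Fin.snoc_injective2 h).1
  · intro m hm
    simp only [Finset.mem_filter, mem_monoTuples] at hm
    refine ⟨Fin.init m, ?_, ?_⟩
    · rw [mem_monoTuples]
      exact ⟨fun i => hm.1.1 _, fun i j h => hm.1.2 (Fin.castSucc_le_castSucc_iff.2 h)⟩
    · have h := hm.2 (Fin.last r) (by simp)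
      simp only [← h]
      exact Fin.snoc_init_self m
  · intro m _
    rw [Fin.prod_univ_castSucc]
    simp [div_eq_mul_inv]

lemma starSum_succ (e : ℕ → ℕ) (r N : ℕ) :
    starSum e (r + 1) N = ∑ n ∈ Finset.Icc 1 N, starSumLast e (r + 1) n := by
  unfold starSum starSumLast
  rw [← Finset.sum_fiberwise_of_maps_to (t := Finset.Icc 1 N) (g := fun m => m (Fin.last r))
    (fun m hm => Finset.mem_Icc.2 ((mem_monoTuples.1 hm).1 _))]
  refine Finset.sum_congr rfl fun n hn => Finset.sum_congr ?_ fun _ _ => rfl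
  rw [Finset.mem_Icc] at hn
  ext m
  simp only [Finset.mem_filter, mem_monoTuples]
  constructor
  · rintro ⟨⟨h1, h2⟩, h3⟩
    refine ⟨⟨fun i => ⟨(h1 i).1, h3 ▸ h2 (Fin.le_last i)⟩, h2⟩, fun i hi => ?_⟩
    have : i = Fin.last r := Fin.ext (by simpa using hi)
    rw [this, h3]
  · rintro ⟨⟨h1, h2⟩, h3⟩
    exact ⟨⟨fun i => ⟨(h1 i).1, (h1 i).2.trans hn.2⟩, h2⟩, h3 _ (by simp)⟩

lemma starSum_congr {e f : ℕ → ℕ} {r : ℕ} (h : ∀ i < r, e i = f i) (N : ℕ) :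
    starSum e r N = starSum f r N :=
  Finset.sum_congr rfl fun _ _ => Finset.prod_congr rfl fun i _ => by rw [h i i.2]

lemma sStar_append_singleton (k : List ℕ) (a : ℕ) {N : ℕ} (hN : 1 ≤ N) :
    sStar (k ++ [a]) N = starSum (fun i => k.getD i 0) k.length N / (N : ℝ) ^ a := by
  rw [sStar_eq_starSumLast, List.length_append, List.length_singleton, starSumLast_succ _ _ hN]
  congr 1
  · exact starSum_congr (fun i hi => List.getD_append _ _ _ _ hi) N
  · simp

lemma sStar_append_succ (k : List ℕ) (a : ℕ) {N : ℕ} (hN : 1 ≤ N) :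
    sStar (k ++ [a + 1]) N = sStar (k ++ [a]) N / N := by
  rw [sStar_append_singleton _ _ hN, sStar_append_singleton _ _ hN, pow_succ, div_div]

lemma sStar_append_one {k : List ℕ} (hk : k ≠ []) {N : ℕ} (hN : 1 ≤ N) :
    sStar (k ++ [1]) N = SStar k N / N := by
  rw [sStar_append_singleton _ _ hN, pow_one, SStar]
  obtain ⟨r, hr⟩ := Nat.exists_eq_succ_of_ne_zero (mt List.length_eq_zero_iff.1 hk)
  simp only [sStar_eq_starSumLast, hr, Nat.succ_eq_add_one, starSum_succ]

lemma sStar_singleton_one {N : ℕ} (hN : 1 ≤ N) : sStar [1] N = 1 / N := by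
  have h := sStar_append_singleton [] 1 hN
  rw [List.nil_append] at h
  rw [h, pow_one]
  congr 1
  have : monoTuples 0 N = {Fin.elim0} := by
    ext m
    simp [mem_monoTuples, Subsingleton.elim m Fin.elim0, Subsingleton.monotone]
  simp [starSum, this]

lemma SStar_eq_sum_range (k : List ℕ) (N : ℕ) :
    SStar k N = ∑ n ∈ Finset.range N, sStar k (n + 1) := by
  rw [SStar, Finset.range_eq_Ico, Finset.sum_Ico_add' (fun n => sStar k n) 0 N 1]
  rfl

/-- The alternating binomial transform of a sequence. -/
noncomputable def altBinom (a : ℕ → ℝ) (N : ℕ) : ℝ :=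
  ∑ n ∈ Finset.range (N + 1), (-1) ^ n * (N.choose n : ℝ) * a n

lemma sum_altBinom (a : ℕ → ℝ) (N : ℕ) :
    ∑ m ∈ Finset.range N, altBinom a m =
      ∑ n ∈ Finset.range N, (-1) ^ n * (N.choose (n + 1) : ℝ) * a n := by
  induction N with
  | zero => simp
  | succ N ih =>
    rw [Finset.sum_range_succ, ih, altBinom]
    have h : ∑ n ∈ Finset.range N, (-1) ^ n * (N.choose (n + 1) : ℝ) * a n =
        ∑ n ∈ Finset.range (N + 1), (-1) ^ n * (N.choose (n + 1) : ℝ) * a n := by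
      rw [Finset.sum_range_succ]
      simp
    rw [h, ← Finset.sum_add_distrib]
    refine Finset.sum_congr rfl fun n _ => ?_
    rw [Nat.choose_succ_succ]
    push_cast
    ring

lemma succ_mul_altBinom_div (a : ℕ → ℝ) (N : ℕ) :
    ((N : ℝ) + 1) * altBinom (fun n => a n / ((n : ℝ) + 1)) N =
      ∑ n ∈ Finset.range (N + 1), (-1) ^ n * ((N + 1).choose (n + 1) : ℝ) * a n := by
  rw [altBinom, Finset.mul_sum]
  refine Finset.sum_congr rfl fun n _ => ?_
  have h : ((N : ℝ) + 1) * N.choose n = (N + 1).choose (n + 1) * ((n : ℝ) + 1) := by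
    exact_mod_cast Nat.add_one_mul_choose_eq N n
  have hn : (n : ℝ) + 1 ≠ 0 := by positivity
  field_simp
  linear_combination (a n) * h

lemma altBinom_div (a : ℕ → ℝ) (N : ℕ) :
    altBinom (fun n => a n / ((n : ℝ) + 1)) N =
      (∑ m ∈ Finset.range (N + 1), altBinom a m) / ((N : ℝ) + 1) := by
  have hN : (N : ℝ) + 1 ≠ 0 := by positivity
  rw [eq_div_iff hN, mul_comm, succ_mul_altBinom_div, sum_altBinom]

lemma altBinom_sum_div (a : ℕ → ℝ) (N : ℕ) :
    altBinom (fun n => (∑ m ∈ Finset.range (n + 1), a m) / ((n : ℝ) + 1)) N =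
      altBinom a N / ((N : ℝ) + 1) := by
  have hN : (N : ℝ) + 1 ≠ 0 := by positivity
  rw [eq_div_iff hN, mul_comm,
    succ_mul_altBinom_div (fun n => ∑ m ∈ Finset.range (n + 1), a m)]
  set b : ℕ → ℝ := fun n => ∑ m ∈ Finset.range n, a m with hb
  have h1 : ∑ n ∈ Finset.range (N + 1), (-1) ^ n * (N.choose n : ℝ) * b n =
      -∑ n ∈ Finset.range (N + 1), (-1) ^ n * (N.choose (n + 1) : ℝ) * b (n + 1) := by
    rw [Finset.sum_range_succ', Finset.sum_range_succ]
    simp [hb, pow_succ]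
  have h2 : altBinom a N = ∑ n ∈ Finset.range (N + 1),
      ((-1) ^ n * (N.choose n : ℝ) * b (n + 1) - (-1) ^ n * (N.choose n : ℝ) * b n) := by
    refine Finset.sum_congr rfl fun n _ => ?_
    simp only [hb, Finset.sum_range_succ]
    ring
  rw [h2, Finset.sum_sub_distrib, h1, sub_neg_eq_add, ← Finset.sum_add_distrib]
  refine Finset.sum_congr rfl fun n _ => ?_
  rw [Nat.choose_succ_succ]
  push_cast
  ring

/-- Consecutive differences of a list, starting from `0`. -/
def diffs (L : List ℕ) : List ℕ := L.zipWith (fun a b => a - b) (0 :: L)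

lemma zipWith_sub_append_singleton (L : List ℕ) (c x : ℕ) :
    (L ++ [x]).zipWith (fun a b => a - b) (c :: (L ++ [x])) =
      L.zipWith (fun a b => a - b) (c :: L) ++ [x - L.getLastD c] := by
  induction L generalizing c with
  | nil => simp
  | cons y L ih =>
    simp only [List.cons_append, List.zipWith_cons_cons, ih, List.getLastD_cons]

lemma diffs_append_singleton (L : List ℕ) (x : ℕ) :
    diffs (L ++ [x]) = diffs L ++ [x - L.getLastD 0] :=
  zipWith_sub_append_singleton L 0 x

lemma sort_insert_of_lt {S : Finset ℕ} {x : ℕ} (h : ∀ y ∈ S, y < x) :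
    (insert x S).sort (· ≤ ·) = S.sort (· ≤ ·) ++ [x] := by
  have hx : x ∉ S := fun hx => (h x hx).false
  refine List.Perm.eq_of_pairwise (le := (· ≤ ·)) (fun a b _ _ => le_antisymm)
    (Finset.pairwise_sort _ _) ?_ ?_
  · rw [List.pairwise_append]
    refine ⟨Finset.pairwise_sort _ _, by simp, fun a ha b hb => ?_⟩
    rw [List.mem_singleton] at hb
    exact hb ▸ (h a ((Finset.mem_sort _).1 ha)).le
  · rw [List.perm_ext_iff_of_nodup (Finset.sort_nodup _ _)]
    · intro a
      simp [or_comm]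
    · rw [List.nodup_append]
      refine ⟨Finset.sort_nodup _ _, by simp, fun a ha b hb => ?_⟩
      rw [List.mem_singleton] at hb
      exact hb ▸ (h a ((Finset.mem_sort _).1 ha)).ne

/-- The complement of `A(k)` in `{1, …, wt(k) - 1}`, in increasing order. -/
def coList (k : List ℕ) : List ℕ :=
  (Finset.Icc 1 (k.sum - 1) \ Aset k).sort (· ≤ ·)

lemma lt_of_mem_coList {k : List ℕ} {x : ℕ} (hx : x ∈ coList k) : x < k.sum := by
  simp only [coList, Finset.mem_sort, Finset.mem_sdiff, Finset.mem_Icc] at hx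
  omega

lemma getLastD_coList_le (k : List ℕ) : (coList k).getLastD 0 ≤ k.sum := by
  rcases h : coList k with _ | ⟨y, L⟩
  · simp
  · rw [← h, List.getLastD_eq_getLast?, List.getLast?_eq_some_getLast (by simp [h])]
    exact (lt_of_mem_coList (List.getLast_mem _)).le

lemma hdual_eq_diffs {k : List ℕ} : hdual k = diffs (coList k ++ [k.sum]) := by
  rw [coList, ← sort_insert_of_lt]
  · rfl
  · intro y hy
    simp only [Finset.mem_sdiff, Finset.mem_Icc] at hy
    omega

lemma hdual_eq (k : List ℕ) :
    hdual k = diffs (coList k) ++ [k.sum - (coList k).getLastD 0] := by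
  rw [hdual_eq_diffs, diffs_append_singleton]

lemma Aset_append_singleton (k : List ℕ) (a b : ℕ) : Aset (k ++ [a]) = Aset (k ++ [b]) := by
  unfold Aset
  simp only [List.length_append, List.length_singleton]
  refine Finset.image_congr fun i hi => ?_
  simp only [Finset.coe_Ico, Set.mem_Ico] at hi
  simp only [List.take_append_of_le_length (Nat.lt_succ_iff.1 hi.2)]

lemma Aset_append {k : List ℕ} (hk : k ≠ []) (a : ℕ) :
    Aset (k ++ [a]) = insert k.sum (Aset k) := by
  have hl : 1 ≤ k.length := List.length_pos_iff.2 hk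
  unfold Aset
  rw [List.length_append, List.length_singleton, ← Finset.insert_Ico_right_eq_Ico_add_one hl,
    Finset.image_insert]
  congr 1
  · simp
  · refine Finset.image_congr fun i hi => ?_
    simp only [Finset.coe_Ico, Set.mem_Ico] at hi
    simp only [List.take_append_of_le_length hi.2.le]

lemma sum_notMem_Aset {k : List ℕ} (hpos : ∀ x ∈ k, 0 < x) : k.sum ∉ Aset k := by
  simp only [Aset, Finset.mem_image, Finset.mem_Ico, not_exists, not_and]
  intro i hi h
  have h1 := List.sum_take_add_sum_drop k i
  have h2 : 0 < (k.drop i).sum :=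
    List.sum_pos _ (fun x hx => hpos x (List.mem_of_mem_drop hx))
      (by simpa using hi.2)
  omega

lemma hdual_append_succ {k : List ℕ} {a : ℕ} (hpos : ∀ x ∈ k ++ [a], 0 < x) :
    hdual (k ++ [a + 1]) = hdual (k ++ [a]) ++ [1] := by
  have hs : (k ++ [a + 1]).sum = (k ++ [a]).sum + 1 := by simp [add_assoc]
  have hw : 0 < (k ++ [a]).sum := List.sum_pos _ hpos (by simp)
  have hc : coList (k ++ [a + 1]) = coList (k ++ [a]) ++ [(k ++ [a]).sum] := by
    have hn := sum_notMem_Aset hpos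
    rw [coList, coList, ← sort_insert_of_lt, hs, Aset_append_singleton k (a + 1) a]
    · congr 1
      ext x
      simp only [Finset.mem_sdiff, Finset.mem_Icc, Finset.mem_insert]
      by_cases hx : x = (k ++ [a]).sum
      · subst hx
        simp only [hn]
        simp only [not_false_eq_true, true_or, and_true, iff_true]
        omega
      · simp only [hx, false_or]
        refine and_congr_left fun _ => ?_
        omega
    · intro y hy
      simp only [Finset.mem_sdiff, Finset.mem_Icc] at hy
      omega
  rw [hdual_eq_diffs, hc, diffs_append_singleton, ← hdual_eq_diffs, hs]
  simp

lemma hdual_append_one {k : List ℕ} (hk : k ≠ []) (hpos : ∀ x ∈ k, 0 < x) :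
    ∃ (l : List ℕ) (b : ℕ), hdual k = l ++ [b] ∧ hdual (k ++ [1]) = l ++ [b + 1] := by
  have hw : 0 < k.sum := List.sum_pos _ hpos hk
  have hs : (k ++ [1]).sum = k.sum + 1 := by simp
  refine ⟨_, _, hdual_eq k, ?_⟩
  have hc : coList (k ++ [1]) = coList k := by
    rw [coList, coList, hs, Aset_append hk]
    congr 1
    ext x
    simp only [Finset.mem_sdiff, Finset.mem_Icc, Finset.mem_insert, not_or, ← and_assoc]
    refine and_congr_left fun _ => ?_
    omega
  rw [hdual_eq, hc, hs, Nat.sub_add_comm (getLastD_coList_le k)]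

lemma hdual_ne_nil (k : List ℕ) : hdual k ≠ [] := by
  simp [hdual_eq]

lemma hdual_singleton_one : hdual [1] = [1] := by
  simp [hdual_eq, coList, diffs]

/-- Duality for star sums: the alternating binomial transform exchanges `k` and `k∨`. -/
theorem sStar_eq_altBinom_hdual {k : List ℕ} (hk : k ≠ []) (hpos : ∀ x ∈ k, 0 < x) (N : ℕ) :
    sStar k (N + 1) = altBinom (fun n => sStar (hdual k) (n + 1)) N := by
  induction k using List.reverseRecOn generalizing N with
  | nil => exact absurd rfl hk
  | append_singleton k a ih =>
    have ha : 1 ≤ a := hpos a (by simp)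
    have hkpos : ∀ x ∈ k, 0 < x := fun x hx => hpos x (List.mem_append_left _ hx)
    clear hpos hk
    induction a, ha using Nat.le_induction generalizing N with
    | base =>
      by_cases hk : k = []
      · subst hk
        have h := altBinom_sum_div (fun n => if n = 0 then 1 else 0) N
        simp only [List.nil_append, hdual_singleton_one,
          sStar_singleton_one (Nat.le_add_left 1 _), Nat.cast_add, Nat.cast_one]
        simpa [altBinom] using h.symm
      · obtain ⟨l, b, h1, h2⟩ := hdual_append_one hk hkpos
        simp only [h2, sStar_append_succ l b (Nat.le_add_left 1 _), ← h1,
          sStar_append_one hk (Nat.le_add_left 1 _), Nat.cast_add, Nat.cast_one,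
          altBinom_div (fun n => sStar (hdual k) (n + 1)), SStar_eq_sum_range, ih hk hkpos]
    | succ a ha iha =>
      have hp : ∀ x ∈ k ++ [a], 0 < x := by
        intro x hx
        rcases List.mem_append.1 hx with hx | hx
        · exact hkpos x hx
        · rw [List.mem_singleton] at hx
          omega
      simp only [hdual_append_succ hp, sStar_append_succ k a (Nat.le_add_left 1 _), iha,
        sStar_append_one (hdual_ne_nil _) (Nat.le_add_left 1 _), SStar_eq_sum_range,
        Nat.cast_add, Nat.cast_one, altBinom_sum_div (fun n => sStar (hdual (k ++ [a])) (n + 1))]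

lemma cbinom_natCast (N n : ℕ) : cbinom (N : ℂ) n = (N.choose n : ℂ) := by
  rw [cbinom, descPochhammer_eval_eq_descFactorial, Nat.descFactorial_eq_factorial_mul_choose,
    Nat.cast_mul, mul_div_cancel_left₀]
  exact_mod_cast n.factorial_ne_zero

/-- Interpolation property: `F_k(N) = S⋆(k, N)` for all integers `N ≥ 0`. -/
theorem F_interpolation (k : List ℕ) (hk : k ≠ []) (hpos : ∀ x ∈ k, 0 < x) (N : ℕ) :
    F k (N : ℂ) = ((SStar k N : ℝ) : ℂ) := by
  rw [F, if_neg hk, tsum_eq_sum (s := Finset.range N), SStar_eq_sum_range]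
  · simp only [sStar_eq_altBinom_hdual hk hpos, sum_altBinom, cbinom_natCast]
    push_cast
    exact Finset.sum_congr rfl fun n _ => by ring
  · intro n hn
    rw [Finset.mem_range, not_lt] at hn
    rw [cbinom_natCast, Nat.choose_eq_zero_of_lt (Nat.lt_succ_of_le hn)]
    simp

end Kawashima
end

section
/- For every integer m≥1 and every z∈ℂ with Re(z)>−1, the Kawashima function of the single-entry index (m+1) satisfies F_{(m+1)}(z) = (−1)^m/m! · ψ^{(m)}(z+1) + ζ(m+1), where ψ^{(m)} is the m-th derivative of the digamma function ψ(z)=Γ'(z)/Γ(z) and ζ is the Riemann zeta function. For m=0 one has F_{(1)}(z)=ψ(z+1)+γ, where γ is the Euler–Mascheroni constant. -/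
open MeasureTheory Filter Topology

namespace Kawashima

/-- The coefficients of the Newton series of `z ↦ 1 / (n + z) ^ p`, up to the sign `(-1) ^ N`. -/
noncomputable def newtonCoeff : ℕ → ℕ → ℕ → ℝ
  | 0, _, 0 => 1
  | 0, _, _ + 1 => 0
  | p + 1, n, 0 => newtonCoeff p n 0 / n
  | p + 1, n, N + 1 =>
      ((N + 1) * newtonCoeff (p + 1) n N + newtonCoeff p n (N + 1)) / (n + N + 1)

lemma newtonCoeff_nonneg (p n N : ℕ) : 0 ≤ newtonCoeff p n N := by
  induction p generalizing N with
  | zero => cases N <;> simp [newtonCoeff]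
  | succ p ihp =>
    induction N with
    | zero => rw [newtonCoeff]; have := ihp 0; positivity
    | succ N ih => rw [newtonCoeff]; have := ihp (N + 1); positivity

lemma newtonCoeff_zero_right (p n : ℕ) : newtonCoeff p n 0 = 1 / (n : ℝ) ^ p := by
  induction p with
  | zero => simp [newtonCoeff]
  | succ p ih => rw [newtonCoeff, ih, pow_succ, div_div]

lemma newtonCoeff_succ_succ {n : ℕ} (p N : ℕ) :
    (n + N + 1) * newtonCoeff (p + 1) n (N + 1) =
      (N + 1) * newtonCoeff (p + 1) n N + newtonCoeff p n (N + 1) := by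
  rw [newtonCoeff]
  field_simp

lemma newtonCoeff_succ_zero {n : ℕ} (hn : 0 < n) (p : ℕ) :
    n * newtonCoeff (p + 1) n 0 = newtonCoeff p n 0 := by
  rw [newtonCoeff]
  field_simp

lemma newtonCoeff_succ_right {n : ℕ} (hn : 0 < n) (p N : ℕ) :
    newtonCoeff p n (N + 1) = newtonCoeff p n N - newtonCoeff p (n + 1) N := by
  induction p generalizing N with
  | zero => cases N <;> simp [newtonCoeff]
  | succ p ihp =>
    have hpos : (n + N + 1 : ℝ) ≠ 0 := by positivity
    apply mul_left_cancel₀ hpos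
    induction N with
    | zero =>
      have h1 := newtonCoeff_succ_succ (n := n) p 0
      have h2 := newtonCoeff_succ_zero hn p
      have h3 := newtonCoeff_succ_zero n.succ_pos p
      have h4 := ihp 0
      push_cast at *
      linear_combination h1 - h2 + h3 + h4
    | succ N ih =>
      have h0 := mul_left_cancel₀ (by positivity : (n + N + 1 : ℝ) ≠ 0) (ih (by positivity))
      have h1 := newtonCoeff_succ_succ (n := n) p (N + 1)
      have h2 := newtonCoeff_succ_succ (n := n) p N
      have h3 := newtonCoeff_succ_succ (n := n + 1) p N
      have h4 := ihp (N + 1)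
      push_cast at *
      linear_combination h1 - h2 + h3 + h4 + (N + 1 : ℝ) * h0

lemma newtonCoeff_le {n : ℕ} (hn : 0 < n) (p N : ℕ) :
    newtonCoeff p n N ≤ 1 / (n : ℝ) ^ p := by
  induction N with
  | zero => rw [newtonCoeff_zero_right]
  | succ N ih =>
    rw [newtonCoeff_succ_right hn]
    linarith [newtonCoeff_nonneg p (n + 1) N]

lemma hasSum_newtonCoeff (p N : ℕ) :
    HasSum (fun n : ℕ => newtonCoeff (p + 1) (n + 1) (N + 1)) (newtonCoeff (p + 1) 1 N) := by
  have hlim : Tendsto (fun n : ℕ => newtonCoeff (p + 1) (n + 1) N) atTop (𝓝 0) := by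
    refine squeeze_zero (fun n => newtonCoeff_nonneg _ _ _)
      (fun n => (newtonCoeff_le n.succ_pos _ _).trans ?_) tendsto_one_div_add_atTop_nhds_zero_nat
    push_cast
    gcongr
    exact le_self_pow₀ (by linarith [n.cast_nonneg (α := ℝ)]) p.succ_ne_zero
  rw [hasSum_iff_tendsto_nat_of_nonneg fun n => newtonCoeff_nonneg _ _ _]
  simp only [newtonCoeff_succ_right (Nat.succ_pos _)]
  simp_rw [Finset.sum_range_sub' (fun n => newtonCoeff (p + 1) (n + 1) N)]
  simpa using hlim.const_sub (newtonCoeff (p + 1) 1 N)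

lemma newtonCoeff_succ_eq {n : ℕ} (hn : 0 < n) (p N : ℕ) :
    (n + N) * newtonCoeff (p + 1) n N =
      N * newtonCoeff (p + 1) n (N - 1) + newtonCoeff p n N := by
  cases N with
  | zero => simpa using newtonCoeff_succ_zero hn p
  | succ N =>
    have := newtonCoeff_succ_succ (n := n) p N
    rw [Nat.add_sub_cancel]
    push_cast
    linear_combination this

lemma cbinom_zero (z : ℂ) : cbinom z 0 = 1 := by simp [cbinom]

lemma succ_mul_cbinom_succ (z : ℂ) (N : ℕ) :
    (N + 1) * cbinom z (N + 1) = cbinom z N * (z - N) := by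
  have h1 : (N + 1 : ℂ) ≠ 0 := by exact_mod_cast N.succ_ne_zero
  have h2 : (N.factorial : ℂ) ≠ 0 := by exact_mod_cast N.factorial_ne_zero
  rw [cbinom, cbinom, descPochhammer_succ_right, Nat.factorial_succ]
  simp only [Polynomial.eval_mul, Polynomial.eval_sub, Polynomial.eval_X, Polynomial.eval_natCast]
  push_cast
  field_simp

lemma sum_range_mul_newtonCoeff {n : ℕ} (hn : 0 < n) (p : ℕ) {z : ℂ} {b : ℕ → ℂ}
    (hb : ∀ N : ℕ, (N + 1) * b (N + 1) = b N * (N - z)) (K : ℕ) :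
    (n + z) * ∑ N ∈ Finset.range K, b N * newtonCoeff (p + 1) n N =
      ∑ N ∈ Finset.range K, b N * newtonCoeff p n N -
        K * (b K * newtonCoeff (p + 1) n (K - 1)) := by
  induction K with
  | zero => simp
  | succ K ih =>
    have h := congrArg (fun r : ℝ => (r : ℂ)) (newtonCoeff_succ_eq hn p K)
    push_cast at h
    rw [Finset.sum_range_succ, Finset.sum_range_succ, mul_add, ih, Nat.add_sub_cancel]
    push_cast
    linear_combination b K * h + newtonCoeff (p + 1) n K * hb K

lemma summable_mul_newtonCoeff_zero (b : ℕ → ℝ) (n : ℕ) :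
    Summable fun N => b N * newtonCoeff 0 n N := by
  apply summable_of_ne_finset_zero (s := {0})
  intro N hN
  obtain ⟨N, rfl⟩ := Nat.exists_eq_succ_of_ne_zero (by simpa using hN)
  simp [newtonCoeff]

lemma succ_mul_norm_cbinom_succ (z : ℂ) (N : ℕ) :
    (N + 1) * ‖cbinom z (N + 1)‖ = ‖cbinom z N‖ * ‖N - z‖ := by
  rw [norm_sub_rev, ← norm_mul, ← succ_mul_cbinom_succ, norm_mul]
  norm_cast

lemma norm_natCast_sub_ofReal {x : ℝ} (hx0 : x < 0) (N : ℕ) : ‖(N - x : ℂ)‖ = N - x := by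
  rw [← Complex.ofReal_natCast, ← Complex.ofReal_sub, Complex.norm_real, Real.norm_of_nonneg]
  linarith [N.cast_nonneg (α := ℝ)]

lemma summable_norm_cbinom_ofReal_mul_newtonCoeff {x : ℝ} (hx : -1 < x) (hx0 : x < 0) {n : ℕ}
    (hn : 0 < n) (p : ℕ) : Summable fun N => ‖cbinom x N‖ * newtonCoeff p n N := by
  have hrec (N : ℕ) :
      (N + 1 : ℂ) * (‖cbinom x (N + 1)‖ : ℝ) = (‖cbinom x N‖ : ℝ) * (N - (x : ℂ)) := by
    have h := succ_mul_norm_cbinom_succ x N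
    rw [norm_natCast_sub_ofReal hx0] at h
    exact_mod_cast h
  have hnx : 0 < n + x := by
    have : (1 : ℝ) ≤ n := by exact_mod_cast hn
    linarith
  have hnn (p N : ℕ) : 0 ≤ ‖cbinom x N‖ * newtonCoeff p n N :=
    mul_nonneg (norm_nonneg _) (newtonCoeff_nonneg _ _ _)
  induction p with
  | zero => exact summable_mul_newtonCoeff_zero _ n
  | succ p ih =>
    refine summable_of_sum_range_le (c := (∑' N, ‖cbinom x N‖ * newtonCoeff p n N) / (n + x))
      (hnn _) fun K => ?_
    rw [le_div_iff₀' hnx]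
    have h := sum_range_mul_newtonCoeff (b := fun N => (‖cbinom x N‖ : ℝ)) hn p hrec K
    norm_cast at h
    rw [h]
    have h1 := ih.sum_le_tsum (Finset.range K) fun N _ => hnn p N
    have h2 := mul_nonneg K.cast_nonneg
      (mul_nonneg (norm_nonneg (cbinom x K)) (newtonCoeff_nonneg (p + 1) n (K - 1)))
    linarith

lemma norm_cbinom_ofReal_pos {x : ℝ} (hx0 : x < 0) (N : ℕ) : 0 < ‖cbinom x N‖ := by
  induction N with
  | zero => simp [cbinom_zero]
  | succ N ih =>
    have h : (N - x : ℂ) ≠ 0 := by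
      rw [sub_ne_zero]
      norm_cast
      linarith [N.cast_nonneg (α := ℝ)]
    have h2 : (0 : ℝ) < (N + 1) * ‖cbinom x (N + 1)‖ := by
      rw [succ_mul_norm_cbinom_succ]
      exact mul_pos ih (norm_pos_iff.2 h)
    exact pos_of_mul_pos_right h2 (by positivity)

lemma eventually_norm_natCast_sub_le {z : ℂ} {x : ℝ} (hx0 : x < 0) (hxz : x < z.re) :
    ∀ᶠ N : ℕ in atTop, ‖(N - z : ℂ)‖ ≤ ‖(N - x : ℂ)‖ := by
  filter_upwards [(tendsto_natCast_atTop_atTop (R := ℝ)).eventually_ge_atTop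
    ((z.re ^ 2 + z.im ^ 2 - x ^ 2) / (2 * (z.re - x)))] with N hN
  rw [div_le_iff₀ (by linarith)] at hN
  rw [norm_natCast_sub_ofReal hx0]
  apply le_of_sq_le_sq _ (by linarith [N.cast_nonneg (α := ℝ)])
  rw [Complex.sq_norm, Complex.normSq_apply]
  simp only [Complex.sub_re, Complex.natCast_re, Complex.sub_im, Complex.natCast_im]
  nlinarith

lemma exists_norm_cbinom_le {z : ℂ} {x : ℝ} (hx0 : x < 0) (hxz : x < z.re) :
    ∃ C, 0 ≤ C ∧ ∀ᶠ N : ℕ in atTop, ‖cbinom z N‖ ≤ C * ‖cbinom x N‖ := by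
  obtain ⟨K, hK⟩ := eventually_atTop.1 (eventually_norm_natCast_sub_le hx0 hxz)
  refine ⟨‖cbinom z K‖ / ‖cbinom x K‖, by positivity, eventually_atTop.2 ⟨K, fun N hN => ?_⟩⟩
  induction N, hN using Nat.le_induction with
  | base => rw [div_mul_cancel₀ _ (norm_cbinom_ofReal_pos hx0 K).ne']
  | succ N hN ih =>
    have hN1 : (0 : ℝ) < N + 1 := by positivity
    refine le_of_mul_le_mul_left ?_ hN1
    calc (N + 1) * ‖cbinom z (N + 1)‖
        = ‖cbinom z N‖ * ‖(N - z : ℂ)‖ := succ_mul_norm_cbinom_succ z N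
      _ ≤ ‖cbinom z K‖ / ‖cbinom x K‖ * ‖cbinom x N‖ * ‖(N - x : ℂ)‖ := by
        gcongr
        exact hK N hN
      _ = (N + 1) * (‖cbinom z K‖ / ‖cbinom x K‖ * ‖cbinom x (N + 1)‖) := by
        rw [mul_assoc, ← succ_mul_norm_cbinom_succ]
        ring

lemma norm_cbinom_ofReal_succ_le {x : ℝ} (hx : -1 < x) (hx0 : x < 0) (N : ℕ) :
    ‖cbinom x (N + 1)‖ ≤ ‖cbinom x N‖ := by
  have hN1 : (0 : ℝ) < N + 1 := by positivity
  refine le_of_mul_le_mul_left ?_ hN1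
  rw [succ_mul_norm_cbinom_succ, norm_natCast_sub_ofReal hx0, mul_comm]
  gcongr
  linarith

lemma exists_mem_Ioo_neg_one_zero_lt {z : ℂ} (hz : -1 < z.re) :
    ∃ x : ℝ, -1 < x ∧ x < 0 ∧ x < z.re := by
  obtain ⟨x, hx, hx'⟩ := exists_between (lt_min neg_one_lt_zero hz)
  exact ⟨x, hx, (lt_min_iff.1 hx').1, (lt_min_iff.1 hx').2⟩

lemma summable_norm_cbinom_mul_newtonCoeff {z : ℂ} (hz : -1 < z.re) {n : ℕ} (hn : 0 < n)
    (p : ℕ) : Summable fun N => ‖cbinom z N‖ * newtonCoeff p n N := by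
  obtain ⟨x, hx, hx0, hxz⟩ := exists_mem_Ioo_neg_one_zero_lt hz
  obtain ⟨C, -, hC⟩ := exists_norm_cbinom_le hx0 hxz
  refine .of_norm_bounded_eventually_nat
    ((summable_norm_cbinom_ofReal_mul_newtonCoeff hx hx0 hn p).mul_left C) ?_
  filter_upwards [hC] with N hN
  have hc := newtonCoeff_nonneg p n N
  rw [norm_mul, norm_norm, Real.norm_of_nonneg hc, ← mul_assoc]
  gcongr

lemma summable_norm_cbinom_succ_mul_newtonCoeff {z : ℂ} (hz : -1 < z.re) {n : ℕ} (hn : 0 < n)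
    (p : ℕ) : Summable fun N => ‖cbinom z (N + 1)‖ * newtonCoeff p n N := by
  obtain ⟨x, hx, hx0, hxz⟩ := exists_mem_Ioo_neg_one_zero_lt hz
  obtain ⟨C, hC0, hC⟩ := exists_norm_cbinom_le hx0 hxz
  refine .of_norm_bounded_eventually_nat
    ((summable_norm_cbinom_ofReal_mul_newtonCoeff hx hx0 hn p).mul_left C) ?_
  filter_upwards [(tendsto_add_atTop_nat 1).eventually hC] with N hN
  have hc := newtonCoeff_nonneg p n N
  rw [norm_mul, norm_norm, Real.norm_of_nonneg hc, ← mul_assoc]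
  gcongr
  exact hN.trans (by gcongr; exact norm_cbinom_ofReal_succ_le hx hx0 N)

lemma eq_zero_of_tendsto_natCast_mul {a : ℕ → ℂ} {l : ℂ} (ha : Summable fun K => ‖a K‖)
    (h : Tendsto (fun K : ℕ => (K : ℂ) * a K) atTop (𝓝 l)) : l = 0 := by
  by_contra hl
  have hl' : 0 < ‖l‖ := norm_pos_iff.2 hl
  refine Real.not_summable_one_div_natCast
    (.of_norm_bounded_eventually_nat (ha.mul_left (2 / ‖l‖)) ?_)
  filter_upwards [h.norm.eventually_const_lt (half_lt_self hl'), eventually_gt_atTop 0]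
    with K hK hK0
  have hK0' : (0 : ℝ) < K := by exact_mod_cast hK0
  rw [norm_mul, Complex.norm_natCast] at hK
  rw [Real.norm_of_nonneg (by positivity), div_le_iff₀ hK0', div_mul_eq_mul_div,
    div_mul_eq_mul_div, le_div_iff₀ hl']
  linarith

lemma natCast_add_ne_zero {z : ℂ} (hz : -1 < z.re) {n : ℕ} (hn : 0 < n) : (n + z : ℂ) ≠ 0 := by
  intro h
  have h1 := congrArg Complex.re h
  have h2 : (1 : ℝ) ≤ n := by exact_mod_cast hn
  simp at h1
  linarith

lemma hasSum_cbinom_mul_newtonCoeff {z : ℂ} (hz : -1 < z.re) {n : ℕ} (hn : 0 < n) (p : ℕ) :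
    HasSum (fun N => (-1) ^ N * cbinom z N * newtonCoeff p n N) (1 / (n + z) ^ p) := by
  have hnorm (p N : ℕ) : ‖(-1) ^ N * cbinom z N * newtonCoeff p n N‖ =
      ‖cbinom z N‖ * newtonCoeff p n N := by
    simp [abs_of_nonneg (newtonCoeff_nonneg p n N)]
  induction p with
  | zero =>
    have h := hasSum_single (f := fun N => (-1) ^ N * cbinom z N * newtonCoeff 0 n N) 0
      fun N hN => by
        obtain ⟨N, rfl⟩ := Nat.exists_eq_succ_of_ne_zero hN
        simp [newtonCoeff]
    simpa [newtonCoeff, cbinom_zero] using h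
  | succ p ih =>
    have hs : Summable fun N => (-1) ^ N * cbinom z N * newtonCoeff (p + 1) n N := by
      refine .of_norm ?_
      simp_rw [hnorm]
      exact summable_norm_cbinom_mul_newtonCoeff hz hn (p + 1)
    obtain ⟨S, hS⟩ := hs
    have hrec (N : ℕ) : (N + 1 : ℂ) * ((-1) ^ (N + 1) * cbinom z (N + 1)) =
        (-1) ^ N * cbinom z N * (N - z) := by
      linear_combination (-1) ^ (N + 1) * succ_mul_cbinom_succ z N
    have hlim := ih.tendsto_sum_nat.sub (hS.tendsto_sum_nat.const_mul (n + z : ℂ))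
    simp_rw [sum_range_mul_newtonCoeff (b := fun N => (-1) ^ N * cbinom z N) hn p hrec,
      sub_sub_cancel] at hlim
    have h0 := eq_zero_of_tendsto_natCast_mul ?_ hlim
    · convert hS using 1
      rw [pow_succ, ← div_div, sub_eq_zero.1 h0, mul_div_cancel_left₀ _ (natCast_add_ne_zero hz hn)]
    · rw [← summable_nat_add_iff 1]
      simp_rw [Nat.add_sub_cancel]
      refine (summable_norm_cbinom_succ_mul_newtonCoeff hz hn (p + 1)).congr fun N => ?_
      simp [abs_of_nonneg (newtonCoeff_nonneg (p + 1) n N)]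

lemma hasSum_cbinom_succ_mul_newtonCoeff_succ {z : ℂ} (hz : -1 < z.re) {n : ℕ} (hn : 0 < n)
    (p : ℕ) : HasSum (fun N => (-1) ^ N * cbinom z (N + 1) * newtonCoeff p n (N + 1))
      (1 / (n : ℂ) ^ p - 1 / (n + z) ^ p) := by
  have h := ((hasSum_nat_add_iff' 1).2 (hasSum_cbinom_mul_newtonCoeff hz hn p)).neg
  rw [Finset.sum_range_one, newtonCoeff_zero_right, cbinom_zero] at h
  push_cast at h
  rw [pow_zero, one_mul, one_mul, neg_sub] at h
  exact h.congr_fun fun N => by ring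

lemma tsum_cbinom_succ_mul_newtonCoeff {z : ℂ} (hz : -1 < z.re) (p : ℕ) :
    ∑' N, (-1) ^ N * (newtonCoeff (p + 1) 1 N : ℂ) * cbinom z (N + 1) =
      ∑' n : ℕ, (1 / (n + 1 : ℂ) ^ (p + 1) - 1 / (n + 1 + z) ^ (p + 1)) := by
  let f : ℕ → ℕ → ℂ := fun N n =>
    (-1) ^ N * cbinom z (N + 1) * newtonCoeff (p + 1) (n + 1) (N + 1)
  have hnorm (N n : ℕ) : ‖f N n‖ = ‖cbinom z (N + 1)‖ * newtonCoeff (p + 1) (n + 1) (N + 1) := by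
    simp [f, abs_of_nonneg (newtonCoeff_nonneg (p + 1) (n + 1) (N + 1))]
  have hf : Summable (Function.uncurry f) := by
    refine .of_norm ((summable_prod_of_nonneg fun _ => norm_nonneg _).2 ⟨fun N => ?_, ?_⟩)
    · simp only [Function.uncurry_apply_pair, hnorm]
      exact (hasSum_newtonCoeff p N).summable.mul_left _
    · simp only [Function.uncurry_apply_pair, hnorm, tsum_mul_left,
        (hasSum_newtonCoeff p _).tsum_eq]
      exact summable_norm_cbinom_succ_mul_newtonCoeff hz one_pos (p + 1)
  calc ∑' N, (-1) ^ N * (newtonCoeff (p + 1) 1 N : ℂ) * cbinom z (N + 1)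
      = ∑' N, ∑' n, f N n := by
        refine tsum_congr fun N => ?_
        rw [tsum_mul_left, ← Complex.ofReal_tsum, (hasSum_newtonCoeff p N).tsum_eq]
        ring
    _ = ∑' n, ∑' N, f N n := hf.tsum_comm.symm
    _ = _ := by
        refine tsum_congr fun n => ?_
        have h := (hasSum_cbinom_succ_mul_newtonCoeff_succ hz n.succ_pos (p + 1)).tsum_eq
        push_cast at h
        exact h

lemma hdual_singleton (m : ℕ) : hdual [m + 1] = List.replicate (m + 1) 1 := by
  have hL : (insert (m + 1) (Finset.Icc 1 m)).sort (· ≤ ·) = List.range' 1 (m + 1) := by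
    have h : insert (m + 1) (Finset.Icc 1 m) = (List.range' 1 (m + 1)).toFinset := by
      ext a
      simp only [Finset.mem_insert, Finset.mem_Icc, List.mem_toFinset, List.mem_range'_1]
      omega
    rw [h, List.toFinset_sort _ List.nodup_range']
    exact List.pairwise_le_range'
  have hA : Aset [m + 1] = ∅ := by simp [Aset]
  simp only [hdual, hA, List.sum_singleton, Nat.add_sub_cancel, Finset.sdiff_empty, hL]
  apply List.ext_getElem
  · simp
  · intro i h1 h2
    cases i <;> simp
    omega

/-- The complete homogeneous symmetric polynomial of degree `r` in `1, 1/2, …, 1/N`. -/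
noncomputable def harmonicHsymm (r N : ℕ) : ℝ :=
  ∑ m ∈ monoTuples r N, ∏ i, 1 / (m i : ℝ)

lemma sum_monoTuples_last_eq (r : ℕ) {N : ℕ} (hN : 0 < N) :
    ∑ m ∈ monoTuples (r + 1) N with m (Fin.last r) = N, ∏ i, 1 / (m i : ℝ) =
      1 / N * harmonicHsymm r N := by
  rw [harmonicHsymm, Finset.mul_sum]
  refine Finset.sum_nbij' (fun m => Fin.init m) (fun m => Fin.snoc (α := fun _ => ℕ) m N)
    ?_ ?_ ?_ ?_ ?_
  · intro m hm
    rw [Finset.mem_filter, mem_monoTuples] at hm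
    exact mem_monoTuples.2 ⟨fun i => hm.1.1 i.castSucc,
      fun i j hij => hm.1.2 (Fin.castSucc_le_castSucc_iff.2 hij)⟩
  · intro m hm
    rw [mem_monoTuples] at hm
    rw [Finset.mem_filter, mem_monoTuples]
    refine ⟨⟨fun i => ?_, fun i j hij => ?_⟩, by simp⟩
    · induction i using Fin.lastCases with
      | last => simpa using Nat.succ_le_of_lt hN
      | cast i => simpa using hm.1 i
    · induction j using Fin.lastCases with
      | last =>
        induction i using Fin.lastCases with
        | last => simp
        | cast i => simpa using (hm.1 i).2
      | cast j =>
        induction i using Fin.lastCases with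
        | last => exact absurd hij (by simp)
        | cast i => simpa using hm.2 (Fin.castSucc_le_castSucc_iff.1 hij)
  · intro m hm
    rw [Finset.mem_filter] at hm
    nth_rewrite 2 [← Fin.snoc_init_self m]
    rw [hm.2]
  · intro m _
    exact Fin.init_snoc _ _
  · intro m hm
    rw [Finset.mem_filter] at hm
    rw [Fin.prod_univ_castSucc, hm.2, mul_comm]
    rfl

lemma harmonicHsymm_zero_left (N : ℕ) : harmonicHsymm 0 N = 1 := by
  have h : monoTuples 0 N = {Fin.elim0} := by
    ext m
    simp [mem_monoTuples, Subsingleton.elim m Fin.elim0, Monotone]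
  simp [harmonicHsymm, h]

lemma harmonicHsymm_succ_zero (r : ℕ) : harmonicHsymm (r + 1) 0 = 0 := by
  apply Finset.sum_eq_zero
  intro m hm
  have := (mem_monoTuples.1 hm).1 0
  omega

lemma harmonicHsymm_succ_succ (r N : ℕ) :
    harmonicHsymm (r + 1) (N + 1) =
      harmonicHsymm (r + 1) N + 1 / (N + 1 : ℕ) * harmonicHsymm r (N + 1) := by
  have h : (monoTuples (r + 1) (N + 1)).filter (fun m => ¬ m (Fin.last r) = N + 1) =
      monoTuples (r + 1) N := by
    ext m
    rw [Finset.mem_filter, mem_monoTuples, mem_monoTuples]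
    constructor
    · rintro ⟨⟨h1, h2⟩, h3⟩
      refine ⟨fun i => ⟨(h1 i).1, ?_⟩, h2⟩
      have := h2 (Fin.le_last i)
      have := (h1 (Fin.last r)).2
      omega
    · rintro ⟨h1, h2⟩
      have := (h1 (Fin.last r)).2
      exact ⟨⟨fun i => ⟨(h1 i).1, (h1 i).2.trans N.le_succ⟩, h2⟩, by omega⟩
  rw [← sum_monoTuples_last_eq r N.succ_pos, harmonicHsymm,
    ← Finset.sum_filter_add_sum_filter_not _ (fun m => m (Fin.last r) = N + 1), h, add_comm]
  rfl

lemma harmonicHsymm_eq_newtonCoeff (r N : ℕ) :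
    harmonicHsymm r (N + 1) = (N + 1) * newtonCoeff (r + 1) 1 N := by
  induction r generalizing N with
  | zero =>
    rw [harmonicHsymm_zero_left]
    induction N with
    | zero => simp [newtonCoeff]
    | succ N ih =>
      have h := newtonCoeff_succ_eq one_pos 0 (N + 1)
      simp only [newtonCoeff.eq_2, Nat.add_sub_cancel] at h
      push_cast at *
      linear_combination ih - h
  | succ r ihr =>
    have hN (N : ℕ) : harmonicHsymm (r + 1) (N + 1) =
        harmonicHsymm (r + 1) N + newtonCoeff (r + 1) 1 N := by
      rw [harmonicHsymm_succ_succ, ihr]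
      push_cast
      field_simp
    induction N with
    | zero =>
      rw [hN, harmonicHsymm_succ_zero]
      simp [newtonCoeff]
    | succ N ih =>
      have h := newtonCoeff_succ_eq one_pos (r + 1) (N + 1)
      rw [Nat.add_sub_cancel] at h
      rw [hN, ih]
      push_cast at *
      linear_combination -h

lemma sStar_eq_sum_monoTuples {k : List ℕ} {r : ℕ} (hk : k.length = r + 1)
    (hk1 : ∀ i, k.get i = 1) (N : ℕ) :
    sStar k N =
      ∑ m ∈ monoTuples (r + 1) N with m (Fin.last r) = N, ∏ i, 1 / (m i : ℝ) := by
  rw [sStar]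
  simp only [hk1, pow_one]
  generalize k.length = l at hk
  subst hk
  rw [← Finset.sum_filter]
  refine Finset.sum_nbij (fun m i => (m i : ℕ)) ?_ ?_ ?_ fun _ _ => rfl
  · intro m hm
    obtain ⟨-, h1, h2, h3⟩ := Finset.mem_filter.1 hm
    exact Finset.mem_filter.2 ⟨mem_monoTuples.2 ⟨fun i => ⟨h1 i, Fin.is_le _⟩, h2⟩, h3 _ rfl⟩
  · intro m _ m' _ h
    ext i
    exact congrFun h i
  · intro m hm
    obtain ⟨h1, h3⟩ := Finset.mem_filter.1 hm
    obtain ⟨h1, h2⟩ := mem_monoTuples.1 h1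
    refine ⟨fun i => ⟨m i, Nat.lt_succ_of_le (h1 i).2⟩, ?_, rfl⟩
    refine Finset.mem_coe.2 (Finset.mem_filter.2 ⟨Finset.mem_univ _, fun i => (h1 i).1, h2, ?_⟩)
    intro i hi
    rwa [show i = Fin.last r from Fin.ext (by simpa using hi)]

lemma sStar_hdual_singleton (m N : ℕ) :
    sStar (hdual [m + 1]) (N + 1) = newtonCoeff (m + 1) 1 N := by
  rw [hdual_singleton, sStar_eq_sum_monoTuples (r := m) (by simp) (by simp),
    sum_monoTuples_last_eq m N.succ_pos, harmonicHsymm_eq_newtonCoeff]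
  push_cast
  field_simp

/-- The `m`-th derivative of `1 / (n + 1) - 1 / (n + w)` with respect to `w`. -/
noncomputable def polygammaTerm (m n : ℕ) (w : ℂ) : ℂ :=
  (if m = 0 then 1 / (n + 1 : ℂ) else 0) + (-1) ^ (m + 1) * m.factorial / (n + w) ^ (m + 1)

lemma natCast_add_ne_zero_of_re_pos {w : ℂ} (hw : 0 < w.re) (n : ℕ) : (n + w : ℂ) ≠ 0 := by
  intro h
  have h1 := congrArg Complex.re h
  simp only [Complex.add_re, Complex.natCast_re, Complex.zero_re] at h1
  linarith [n.cast_nonneg (α := ℝ)]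

lemma hasDerivAt_polygammaTerm (m n : ℕ) {w : ℂ} (hw : 0 < w.re) :
    HasDerivAt (polygammaTerm m n) (polygammaTerm (m + 1) n w) w := by
  have h0 := natCast_add_ne_zero_of_re_pos hw n
  have h := ((((hasDerivAt_id w).const_add (n : ℂ)).pow (m + 1)).inv
    (pow_ne_zero _ h0)).const_mul ((-1) ^ (m + 1) * m.factorial : ℂ)
  have h2 := h.const_add (if m = 0 then 1 / (n + 1 : ℂ) else 0)
  refine h2.congr_deriv ?_
  simp only [polygammaTerm, Nat.factorial_succ, id, Pi.pow_apply]
  push_cast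
  field_simp
  simp
  ring

/-- The points of the disc of radius `R` with real part greater than `δ`. For `δ > 0` these sets
exhaust the right half plane by bounded open sets away from its boundary. -/
def rightStrip (δ R : ℝ) : Set ℂ := {w | δ < w.re} ∩ {w | ‖w‖ < R}

lemma isOpen_rightStrip (δ R : ℝ) : IsOpen (rightStrip δ R) :=
  (isOpen_lt continuous_const Complex.continuous_re).inter
    (isOpen_lt continuous_norm continuous_const)

lemma exists_polygammaTerm_bound {δ : ℝ} (hδ : 0 < δ) (R : ℝ) (m : ℕ) :
    ∃ u : ℕ → ℝ, Summable u ∧ ∀ n, ∀ w ∈ rightStrip δ R, ‖polygammaTerm m n w‖ ≤ u n := by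
  let ε := min δ 1
  have hε : 0 < ε := lt_min hδ one_pos
  have hε1 : ε ≤ 1 := min_le_right _ _
  have hs : Summable fun n : ℕ => 1 / ((n : ℝ) + 1) ^ 2 := by
    exact_mod_cast (summable_nat_add_iff 1).2 (Real.summable_one_div_nat_pow.2 one_lt_two)
  have hlow (n : ℕ) {w : ℂ} (hw : w ∈ rightStrip δ R) : ε * (n + 1) ≤ ‖(n + w : ℂ)‖ := by
    have h1 : ε ≤ w.re := (min_le_left _ _).trans hw.1.le
    have h2 := Complex.re_le_norm (n + w : ℂ)
    simp only [Complex.add_re, Complex.natCast_re] at h2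
    nlinarith [n.cast_nonneg (α := ℝ)]
  cases m with
  | zero =>
    refine ⟨fun n => (R + 1) / ε * (1 / ((n : ℝ) + 1) ^ 2), hs.mul_left _, fun n w hw => ?_⟩
    have hR : ‖w - 1‖ ≤ R + 1 := (norm_sub_le _ _).trans (by simpa using hw.2.le)
    have h0 := natCast_add_ne_zero_of_re_pos (hδ.trans hw.1) n
    have hn : (n + 1 : ℂ) ≠ 0 := by exact_mod_cast n.succ_ne_zero
    have h : polygammaTerm 0 n w = (w - 1) / ((n + 1) * (n + w)) := by
      simp only [polygammaTerm, if_true, Nat.factorial_zero, Nat.cast_one, zero_add, pow_one]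
      field_simp
      ring
    have hn' : ‖(n + 1 : ℂ)‖ = n + 1 := by exact_mod_cast Complex.norm_natCast (n + 1)
    rw [h, norm_div, norm_mul, hn']
    calc ‖w - 1‖ / ((n + 1) * ‖(n + w : ℂ)‖) ≤ (R + 1) / ((n + 1) * (ε * (n + 1))) := by
          have := (norm_nonneg _).trans hR
          gcongr
          exact hlow n hw
      _ = _ := by field_simp
  | succ m =>
    refine ⟨fun n => (m + 1).factorial / ε ^ (m + 2) * (1 / ((n : ℝ) + 1) ^ 2), hs.mul_left _,
      fun n w hw => ?_⟩
    have hn1 : (1 : ℝ) ≤ n + 1 := by linarith [n.cast_nonneg (α := ℝ)]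
    have h : ‖polygammaTerm (m + 1) n w‖ = (m + 1).factorial / ‖(n + w : ℂ)‖ ^ (m + 2) := by
      simp [polygammaTerm]
    rw [h]
    calc ((m + 1).factorial : ℝ) / ‖(n + w : ℂ)‖ ^ (m + 2)
        ≤ (m + 1).factorial / (ε ^ (m + 2) * (n + 1) ^ 2) := by
          gcongr
          calc ε ^ (m + 2) * (n + 1 : ℝ) ^ 2 ≤ ε ^ (m + 2) * (n + 1 : ℝ) ^ (m + 2) := by
                gcongr ?_ * ?_
                exact pow_le_pow_right₀ hn1 (by omega)
            _ ≤ _ := by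
                rw [← mul_pow]
                gcongr
                exact hlow n hw
      _ = _ := by field_simp

lemma exists_mem_rightStrip {w : ℂ} (hw : 0 < w.re) : ∃ δ R, 0 < δ ∧ w ∈ rightStrip δ R :=
  ⟨w.re / 2, ‖w‖ + 1, half_pos hw, half_lt_self hw, lt_add_one ‖w‖⟩

lemma summable_polygammaTerm (m : ℕ) {w : ℂ} (hw : 0 < w.re) :
    Summable fun n => polygammaTerm m n w := by
  obtain ⟨δ, R, hδ, hwU⟩ := exists_mem_rightStrip hw
  obtain ⟨u, hu, h⟩ := exists_polygammaTerm_bound hδ R m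
  exact .of_norm_bounded hu fun n => h n w hwU

lemma hasDerivAt_tsum_polygammaTerm (m : ℕ) {w : ℂ} (hw : 0 < w.re) :
    HasDerivAt (fun w => ∑' n, polygammaTerm m n w) (∑' n, polygammaTerm (m + 1) n w) w := by
  obtain ⟨δ, R, hδ, hwU⟩ := exists_mem_rightStrip hw
  obtain ⟨u, hu, h⟩ := exists_polygammaTerm_bound hδ R m
  have hd (n : ℕ) : DifferentiableOn ℂ (polygammaTerm m n) (rightStrip δ R) := fun v hv =>
    (hasDerivAt_polygammaTerm m n (hδ.trans hv.1)).differentiableAt.differentiableWithinAt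
  have hU := isOpen_rightStrip δ R
  have h1 := Complex.hasSum_deriv_of_summable_norm hu hd hU h hwU
  have h2 := Complex.differentiableOn_tsum_of_summable_norm hu hd hU h
  simp_rw [(hasDerivAt_polygammaTerm m _ hw).deriv] at h1
  rw [h1.tsum_eq]
  exact ((h2 w hwU).differentiableAt (hU.mem_nhds hwU)).hasDerivAt

lemma hasDerivAt_log_Gamma {x : ℝ} (hx : 0 < x) :
    HasDerivAt (Real.log ∘ Real.Gamma) (deriv Real.Gamma x / Real.Gamma x) x :=
  (Real.differentiableAt_Gamma fun m => by linarith [m.cast_nonneg (α := ℝ)]).hasDerivAt.log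
    (Real.Gamma_pos_of_pos hx).ne'

lemma log_Gamma_add_one {x : ℝ} (hx : 0 < x) :
    (Real.log ∘ Real.Gamma) (x + 1) = (Real.log ∘ Real.Gamma) x + Real.log x := by
  simp only [Function.comp_apply, Real.Gamma_add_one hx.ne',
    Real.log_mul hx.ne' (Real.Gamma_pos_of_pos hx).ne', add_comm]

lemma logDeriv_Gamma_le_log {x : ℝ} (hx : 0 < x) :
    deriv Real.Gamma x / Real.Gamma x ≤ Real.log x := by
  have h := Real.convexOn_log_Gamma.deriv_le_slope hx (show (0 : ℝ) < x + 1 by linarith)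
    (lt_add_one x) (hasDerivAt_log_Gamma hx).differentiableAt
  rwa [(hasDerivAt_log_Gamma hx).deriv, slope_def_field, log_Gamma_add_one hx,
    add_sub_cancel_left, add_sub_cancel_left, div_one] at h

lemma log_le_logDeriv_Gamma_add_one {x : ℝ} (hx : 0 < x) :
    Real.log x ≤ deriv Real.Gamma (x + 1) / Real.Gamma (x + 1) := by
  have hx1 : 0 < x + 1 := by linarith
  have h := Real.convexOn_log_Gamma.slope_le_deriv hx hx1
    (lt_add_one x) (hasDerivAt_log_Gamma hx1).differentiableAt
  rwa [(hasDerivAt_log_Gamma hx1).deriv, slope_def_field, log_Gamma_add_one hx,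
    add_sub_cancel_left, add_sub_cancel_left, div_one] at h

lemma logDeriv_Gamma_add_one {x : ℝ} (hx : 0 < x) :
    deriv Real.Gamma (x + 1) / Real.Gamma (x + 1) =
      deriv Real.Gamma x / Real.Gamma x + 1 / x := by
  have hx1 : 0 < x + 1 := by linarith
  have h1 := (hasDerivAt_log_Gamma hx1).comp_add_const x 1
  have h2 := (hasDerivAt_log_Gamma hx).add (Real.hasDerivAt_log hx.ne')
  rw [one_div]
  refine h1.unique (h2.congr_of_eventuallyEq ?_)
  filter_upwards [eventually_gt_nhds hx] with y hy using log_Gamma_add_one hy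

lemma logDeriv_Gamma_add_natCast {x : ℝ} (hx : 0 < x) (n : ℕ) :
    deriv Real.Gamma (x + n) / Real.Gamma (x + n) =
      deriv Real.Gamma x / Real.Gamma x + ∑ j ∈ Finset.range n, 1 / (j + x) := by
  induction n with
  | zero => simp
  | succ n ih =>
    rw [Nat.cast_succ, ← add_assoc, logDeriv_Gamma_add_one (by positivity), ih,
      Finset.sum_range_succ, add_comm x, add_assoc]

lemma tendsto_logDeriv_Gamma_sub_log :
    Tendsto (fun x => deriv Real.Gamma x / Real.Gamma x - Real.log x) atTop (𝓝 0) := by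
  have h : Tendsto (fun x : ℝ => -(1 / x)) atTop (𝓝 0) := by
    simpa using (tendsto_inv_atTop_zero (𝕜 := ℝ)).neg
  refine tendsto_of_tendsto_of_tendsto_of_le_of_le' h tendsto_const_nhds ?_ ?_
  · filter_upwards [eventually_gt_atTop 0] with x hx
    have h1 := log_le_logDeriv_Gamma_add_one hx
    rw [logDeriv_Gamma_add_one hx] at h1
    linarith
  · filter_upwards [eventually_gt_atTop 0] with x hx
    linarith [logDeriv_Gamma_le_log hx]

lemma hasSum_logDeriv_Gamma_add_eulerMascheroni {x : ℝ} (hx : 0 < x)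
    (hs : Summable fun n : ℕ => 1 / (n + 1 : ℝ) - 1 / (n + x)) :
    HasSum (fun n : ℕ => 1 / (n + 1 : ℝ) - 1 / (n + x))
      (deriv Real.Gamma x / Real.Gamma x + Real.eulerMascheroniConstant) := by
  rw [hs.hasSum_iff_tendsto_nat]
  have hxn : Tendsto (fun n : ℕ => x + n) atTop atTop :=
    tendsto_atTop_add_const_left _ _ tendsto_natCast_atTop_atTop
  have h1 := tendsto_logDeriv_Gamma_sub_log.comp hxn
  have h2 := Real.tendsto_harmonic_sub_log
  have h3 := (Real.tendsto_log_comp_add_sub_log x).comp (tendsto_natCast_atTop_atTop (R := ℝ))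
  have h4 := ((h2.sub h1).sub h3).add_const (deriv Real.Gamma x / Real.Gamma x)
  convert h4 using 1
  · ext n
    simp only [Function.comp_apply, logDeriv_Gamma_add_natCast hx, Finset.sum_sub_distrib,
      harmonic]
    push_cast
    simp only [one_div]
    rw [add_comm (n : ℝ) x]
    ring
  · congr 1
    ring

lemma digamma_ofReal {x : ℝ} (hx : 0 < x) :
    digamma x = (deriv Real.Gamma x / Real.Gamma x : ℝ) := by
  have hne (m : ℕ) : x ≠ -m := by linarith [m.cast_nonneg (α := ℝ)]
  have h1 := (Complex.differentiableAt_Gamma x fun m => by exact_mod_cast hne m).hasDerivAt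
  have h2 := (Real.differentiableAt_Gamma hne).hasDerivAt.ofReal_comp
  have h3 := h1.comp_ofReal
  simp_rw [Complex.Gamma_ofReal] at h3
  rw [digamma, h3.unique h2, Complex.Gamma_ofReal]
  push_cast
  rfl

lemma digamma_ofReal_eq_tsum {x : ℝ} (hx : 0 < x) :
    digamma x = ∑' n, polygammaTerm 0 n x - Real.eulerMascheroniConstant := by
  have hterm (n : ℕ) : polygammaTerm 0 n x = (1 / (n + 1 : ℝ) - 1 / (n + x) : ℝ) := by
    simp [polygammaTerm, neg_div, sub_eq_add_neg]
  have hs := summable_polygammaTerm 0 (w := x) (by simpa using hx)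
  simp_rw [hterm] at hs ⊢
  have h := hasSum_logDeriv_Gamma_add_eulerMascheroni hx (Complex.summable_ofReal.1 hs)
  rw [← Complex.ofReal_tsum, h.tsum_eq, digamma_ofReal hx]
  push_cast
  ring

lemma isOpen_re_pos : IsOpen {w : ℂ | 0 < w.re} :=
  isOpen_lt continuous_const Complex.continuous_re

lemma differentiableOn_digamma : DifferentiableOn ℂ digamma {w | 0 < w.re} := by
  have hne {w : ℂ} (hw : 0 < w.re) (m : ℕ) : w ≠ -m := by
    intro h
    rw [h] at hw
    simp only [Complex.neg_re, Complex.natCast_re] at hw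
    linarith [m.cast_nonneg (α := ℝ)]
  have hG : DifferentiableOn ℂ Complex.Gamma {w | 0 < w.re} := fun w hw =>
    (Complex.differentiableAt_Gamma w (hne hw)).differentiableWithinAt
  exact (hG.deriv isOpen_re_pos).div hG fun w hw => Complex.Gamma_ne_zero (hne hw)

lemma eqOn_digamma_tsum : Set.EqOn digamma
    (fun w => ∑' n, polygammaTerm 0 n w - Real.eulerMascheroniConstant) {w | 0 < w.re} := by
  have hd : DifferentiableOn ℂ
      (fun w => ∑' n, polygammaTerm 0 n w - (Real.eulerMascheroniConstant : ℂ))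
      {w | 0 < w.re} := fun w hw =>
    ((hasDerivAt_tsum_polygammaTerm 0 hw).sub_const _).differentiableAt.differentiableWithinAt
  have hconv : Convex ℝ {w : ℂ | 0 < w.re} := convex_halfSpace_re_gt 0
  refine (differentiableOn_digamma.analyticOnNhd isOpen_re_pos).eqOn_of_preconnected_of_frequently_eq
    (hd.analyticOnNhd isOpen_re_pos) hconv.isPreconnected
    (z₀ := 1) (by simp) ?_
  have hlim : Tendsto (fun n : ℕ => ((1 + 1 / (n + 1) : ℝ) : ℂ)) atTop (𝓝[≠] 1) := by
    refine tendsto_nhdsWithin_iff.2 ⟨?_, .of_forall fun n => ?_⟩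
    · have h := (tendsto_one_div_add_atTop_nhds_zero_nat (𝕜 := ℝ)).const_add 1
      rw [add_zero] at h
      exact (Complex.continuous_ofReal.tendsto 1).comp h
    · have h : (1 + 1 / (n + 1) : ℝ) ≠ 1 := by
        have : (0 : ℝ) < 1 / (n + 1) := by positivity
        linarith
      rw [Set.mem_compl_singleton_iff, ← Complex.ofReal_one]
      exact Complex.ofReal_injective.ne h
  exact hlim.frequently (.of_forall fun n => digamma_ofReal_eq_tsum (by positivity))

lemma iteratedDeriv_digamma {m : ℕ} (hm : m ≠ 0) {w : ℂ} (hw : 0 < w.re) :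
    iteratedDeriv m digamma w = ∑' n, polygammaTerm m n w := by
  obtain ⟨m, rfl⟩ := Nat.exists_eq_succ_of_ne_zero hm
  clear hm
  induction m generalizing w with
  | zero =>
    rw [iteratedDeriv_one]
    refine (((hasDerivAt_tsum_polygammaTerm 0 hw).sub_const
      (Real.eulerMascheroniConstant : ℂ)).congr_of_eventuallyEq ?_).deriv
    exact eqOn_digamma_tsum.eventuallyEq_of_mem (isOpen_re_pos.mem_nhds hw)
  | succ m ih =>
    rw [iteratedDeriv_succ]
    refine ((hasDerivAt_tsum_polygammaTerm (m + 1) hw).congr_of_eventuallyEq ?_).deriv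
    filter_upwards [isOpen_re_pos.mem_nhds hw] with v hv using ih hv

lemma F_singleton {z : ℂ} (hz : -1 < z.re) (m : ℕ) :
    F [m + 1] z = ∑' n : ℕ, (1 / (n + 1 : ℂ) ^ (m + 1) - 1 / (n + 1 + z) ^ (m + 1)) := by
  rw [F, if_neg (List.cons_ne_nil _ _)]
  simp_rw [sStar_hdual_singleton]
  exact tsum_cbinom_succ_mul_newtonCoeff hz m

lemma summable_one_div_natCast_add_one_pow {m : ℕ} (hm : 1 ≤ m) :
    Summable fun n : ℕ => 1 / (n + 1 : ℂ) ^ (m + 1) := by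
  have h := (summable_nat_add_iff 1).2 (Real.summable_one_div_nat_pow.2 (Nat.lt_succ_of_le hm))
  exact (Complex.summable_ofReal.2 h).congr fun n => by push_cast; rfl

/-- Relation with the polygamma function:
`F_{(m+1)}(z) = (-1)^m/m! · ψ^{(m)}(z+1) + ζ(m+1)` for `m ≥ 1`, and
`F_{(1)}(z) = ψ(z+1) + γ`. -/
theorem F_single_eq_polygamma :
    (∀ m : ℕ, 1 ≤ m → ∀ z : ℂ, -1 < z.re →
      F [m + 1] z =
        (-1 : ℂ) ^ m / (m.factorial : ℕ) * iteratedDeriv m digamma (z + 1) +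
          riemannZeta ((m : ℂ) + 1)) ∧
    (∀ z : ℂ, -1 < z.re →
      F [1] z = digamma (z + 1) + (Real.eulerMascheroniConstant : ℝ)) := by
  refine ⟨fun m hm z hz => ?_, fun z hz => ?_⟩
  · have hw : 0 < (z + 1).re := by
      rw [Complex.add_re, Complex.one_re]
      linarith
    have hm0 : m ≠ 0 := Nat.one_le_iff_ne_zero.1 hm
    have hzeta : riemannZeta ((m : ℂ) + 1) = ∑' n : ℕ, 1 / (n + 1 : ℂ) ^ (m + 1) := by
      rw [zeta_eq_tsum_one_div_nat_add_one_cpow (by simpa using Nat.pos_of_ne_zero hm0)]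
      exact_mod_cast rfl
    have hs := (summable_polygammaTerm m hw).mul_left ((-1 : ℂ) ^ m / m.factorial)
    rw [F_singleton hz, iteratedDeriv_digamma hm0 hw, hzeta, ← tsum_mul_left,
      ← hs.tsum_add (summable_one_div_natCast_add_one_pow hm)]
    refine tsum_congr fun n => ?_
    have hsq : ((-1 : ℂ) ^ m) * (-1) ^ m = 1 := by rw [← mul_pow]; simp
    have hfac : (m.factorial : ℂ) ≠ 0 := by exact_mod_cast m.factorial_ne_zero
    have hterm : (-1 : ℂ) ^ m / m.factorial * polygammaTerm m n (z + 1) =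
        -((-1) ^ m * (-1) ^ m) * (m.factorial / m.factorial) / (n + (z + 1)) ^ (m + 1) := by
      rw [polygammaTerm, if_neg hm0]
      ring
    rw [hterm, hsq, div_self hfac, add_assoc, add_comm z 1]
    ring
  · have hw : 0 < (z + 1).re := by
      rw [Complex.add_re, Complex.one_re]
      linarith
    rw [F_singleton (m := 0) hz, eqOn_digamma_tsum hw, sub_add_cancel]
    refine tsum_congr fun n => ?_
    simp only [polygammaTerm, if_true, Nat.factorial_zero, Nat.cast_one, zero_add, pow_one]
    rw [add_assoc, add_comm z 1]
    ring

end Kawashima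
end
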